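/- arXiv:1201.3256 — 2 statements merged into one kernel-verified Lean document; each statement's English description precedes it below -/
import Mathlib

section
/- Let A be a real p×p matrix such that 0 ∉ σ(A) + σ(A), i.e. no two complex eigenvalues of A sum to zero. Then the linear operator 𝒜 : S_p → S_p defined by 𝒜(X) = AX + XAᵀ is a bijection of the space of symmetric p×p real matrices onto itself; in particular, for every symmetric C there is a unique symmetric X with AX + XAᵀ = C. -/
open Matrix

theorem SemiconjBy.polynomial_aeval {R S : Type*} [CommSemiring R] [Semiring S] [Algebra R S]
    {x a b : S} (h : SemiconjBy x a b) (q : Polynomial R) :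
    SemiconjBy x (Polynomial.aeval a q) (Polynomial.aeval b q) := by
  induction q using Polynomial.induction_on' with
  | add q r hq hr => simpa using hq.add_right hr
  | monomial n c =>
    simp only [Polynomial.aeval_monomial]
    exact SemiconjBy.mul_right (Algebra.commutes c x).symm (h.pow_right n)

/-- The Sylvester equation `X * B = A * X` has only the zero solution when the spectra of `A` and
`B` are disjoint. -/
theorem Matrix.eq_zero_of_semiconjBy_of_disjoint_spectrum {n K : Type*} [Fintype n] [DecidableEq n]
    [Field K] [IsAlgClosed K] {A B X : Matrix n n K}
    (hAB : Disjoint (spectrum K A) (spectrum K B)) (h : SemiconjBy X B A) : X = 0 := by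
  cases isEmpty_or_nonempty n
  · exact Subsingleton.elim _ _
  have hX : Polynomial.aeval A B.charpoly * X = 0 := by
    rw [← (h.polynomial_aeval B.charpoly).eq, Matrix.aeval_self_charpoly, mul_zero]
  have hunit : IsUnit (Polynomial.aeval A B.charpoly) := by
    rw [← spectrum.zero_notMem_iff K, spectrum.map_polynomial_aeval_of_degree_pos]
    · rintro ⟨μ, hμ, hroot⟩
      exact hAB.notMem_of_mem_left hμ (Matrix.mem_spectrum_iff_isRoot_charpoly.mpr hroot)
    · rw [Matrix.charpoly_degree_eq_dim]
      exact_mod_cast Fintype.card_pos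
  exact hunit.mul_right_eq_zero.mp hX

theorem Matrix.spectrum_transpose {n K : Type*} [Fintype n] [DecidableEq n] [Field K]
    (A : Matrix n n K) : spectrum K Aᵀ = spectrum K A := by
  ext μ
  simp only [Matrix.mem_spectrum_iff_isRoot_charpoly, Matrix.charpoly_transpose]

/-- If no two complex eigenvalues of a real matrix `A` sum to zero, then the Lyapunov equation
`A * X + X * Aᵀ = 0` has only the zero solution. -/
theorem Matrix.eq_zero_of_lyapunov_eq_zero {n : Type*} [Fintype n] [DecidableEq n]
    {A X : Matrix n n ℝ}
    (hA : ∀ μ ∈ spectrum ℂ (A.map (Complex.ofReal ·)),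
      ∀ ν ∈ spectrum ℂ (A.map (Complex.ofReal ·)), μ + ν ≠ 0)
    (h : A * X + X * Aᵀ = 0) : X = 0 := by
  have hmap : A.map Complex.ofRealHom * X.map Complex.ofRealHom +
      X.map Complex.ofRealHom * (A.map Complex.ofRealHom)ᵀ = 0 := by
    have := congrArg Complex.ofRealHom.mapMatrix h
    rwa [map_add, map_mul, map_mul, map_zero, RingHom.mapMatrix_apply, RingHom.mapMatrix_apply,
      RingHom.mapMatrix_apply, Matrix.transpose_map] at this
  have hdisj : Disjoint (spectrum ℂ (A.map Complex.ofRealHom))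
      (spectrum ℂ (-(A.map Complex.ofRealHom)ᵀ)) := by
    rw [Set.disjoint_left]
    intro μ hμ hν
    rw [← spectrum.neg_eq, Matrix.spectrum_transpose, Set.mem_neg] at hν
    exact hA μ hμ (-μ) hν (add_neg_cancel μ)
  have hX : X.map Complex.ofRealHom = 0 := by
    refine Matrix.eq_zero_of_semiconjBy_of_disjoint_spectrum hdisj ?_
    rw [SemiconjBy, mul_neg, neg_eq_iff_add_eq_zero, add_comm]
    exact hmap
  exact Matrix.map_injective Complex.ofReal_injective
    (hX.trans (Matrix.map_zero _ Complex.ofReal_zero).symm)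

/-- The Lyapunov operator `X ↦ A * X + X * Aᵀ` on the space of all square matrices. -/
def Matrix.lyapunov {n R : Type*} [Fintype n] [CommRing R] (A : Matrix n n R) :
    Matrix n n R →ₗ[R] Matrix n n R where
  toFun X := A * X + X * Aᵀ
  map_add' X Y := by simp only [mul_add, add_mul]; abel
  map_smul' c X := by simp

/-- If no two complex eigenvalues of the real `p × p` matrix `A` sum to zero,
then the operator `𝒜 : X ↦ A * X + X * Aᵀ` is a bijection of the space of symmetric matrices
onto itself; in particular for every symmetric `C` there is a unique symmetric `X` with
`A * X + X * Aᵀ = C`. -/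
theorem lyapunov_operator_bijective
    (p : ℕ) (A : Matrix (Fin p) (Fin p) ℝ)
    (hA : ∀ μ ∈ spectrum ℂ (A.map (Complex.ofReal ·)),
      ∀ ν ∈ spectrum ℂ (A.map (Complex.ofReal ·)), μ + ν ≠ 0) :
    Function.Bijective
      (fun X : {X : Matrix (Fin p) (Fin p) ℝ // X.IsSymm} =>
        (⟨A * X.1 + X.1 * Aᵀ, by
          have h : X.1ᵀ = X.1 := X.2
          simp [Matrix.IsSymm, Matrix.transpose_add, Matrix.transpose_mul, h, add_comm]⟩ :
          {X : Matrix (Fin p) (Fin p) ℝ // X.IsSymm})) ∧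
    ∀ C : Matrix (Fin p) (Fin p) ℝ, C.IsSymm →
      ∃! X : Matrix (Fin p) (Fin p) ℝ, X.IsSymm ∧ A * X + X * Aᵀ = C := by
  have hinj : Function.Injective (Matrix.lyapunov A) :=
    (injective_iff_map_eq_zero _).mpr fun _ h => Matrix.eq_zero_of_lyapunov_eq_zero hA h
  have hsurj : Function.Surjective (Matrix.lyapunov A) := LinearMap.injective_iff_surjective.mp hinj
  have hsymm : ∀ X : Matrix (Fin p) (Fin p) ℝ, (A * X + X * Aᵀ).IsSymm → X.IsSymm := by
    intro X hX
    apply hinj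
    change A * Xᵀ + Xᵀ * Aᵀ = A * X + X * Aᵀ
    rw [← hX.eq]
    simp [add_comm]
  refine ⟨⟨fun X Y h => Subtype.ext (hinj (congrArg Subtype.val h)), fun C => ?_⟩, fun C hC => ?_⟩
  · obtain ⟨X, hX : A * X + X * Aᵀ = C.1⟩ := hsurj C.1
    exact ⟨⟨X, hsymm X (hX ▸ C.2)⟩, Subtype.ext hX⟩
  · obtain ⟨X, hX : A * X + X * Aᵀ = C⟩ := hsurj C
    exact ⟨X, ⟨hsymm X (hX ▸ hC), hX⟩, fun Y hY => hinj (hY.2.trans hX.symm)⟩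
end

section
/- Let K, M ∈ M_p(ℝ) and suppose every eigenvalue of K (regarded as a complex matrix) has strictly negative real part. Let S : [0,∞) → M_p(ℝ) be differentiable and satisfy the linear matrix ordinary differential equation S'(t) = S(t)K + KᵀS(t) + M for all t ≥ 0. Then there is a unique matrix X₀ ∈ M_p(ℝ) with X₀K + KᵀX₀ + M = 0, and S(t) → X₀ as t → ∞; i.e. the deterministic Wishart equation converges to −𝒞^{−1}(M) where 𝒞(X) = XK + KᵀX. -/
open Matrix Filter

attribute [local instance] Matrix.normedAddCommGroup Matrix.normedSpace

/-- A scalar linear ODE with decay rate faster than that of its exponentially decaying forcing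
term has exponentially decaying solutions. -/
theorem exists_norm_le_exp_of_hasDerivWithinAt {g h : ℝ → ℂ} {l : ℂ} {C δ : ℝ}
    (hl : l.re < -δ)
    (hg : ∀ t : ℝ, 0 ≤ t → HasDerivWithinAt g (l * g t + h t) (Set.Ici 0) t)
    (hh : ∀ t : ℝ, 0 ≤ t → ‖h t‖ ≤ C * Real.exp (-δ * t)) :
    ∃ C', ∀ t : ℝ, 0 ≤ t → ‖g t‖ ≤ C' * Real.exp (-δ * t) := by
  set a : ℝ := -δ - l.re with ha
  have ha0 : 0 < a := by rw [ha]; linarith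
  have hC : 0 ≤ C := by simpa using (norm_nonneg _).trans (hh 0 le_rfl)
  have hnorm : ∀ t : ℝ, ‖Complex.exp (-l * t)‖ = Real.exp (-l.re * t) := fun t => by
    simp [Complex.norm_exp]
  have hexp : ∀ t : ℝ, HasDerivAt (fun t : ℝ => Complex.exp (-l * t))
      (Complex.exp (-l * t) * (-l)) t := fun t => by
    simpa using ((Complex.ofRealCLM.hasDerivAt (x := t)).const_mul (-l)).cexp
  have hu : ∀ t : ℝ, 0 ≤ t → HasDerivWithinAt (fun t : ℝ => Complex.exp (-l * t) * g t)
      (Complex.exp (-l * t) * h t) (Set.Ici 0) t := fun t ht => by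
    refine ((hexp t).hasDerivWithinAt.mul (hg t ht)).congr_deriv ?_
    ring
  have hB : ∀ t : ℝ, HasDerivAt (fun t : ℝ => ‖g 0‖ + C / a * Real.exp (a * t))
      (C * Real.exp (a * t)) t := fun t => by
    refine (((((hasDerivAt_id t).const_mul a).exp).const_mul (C / a)).const_add ‖g 0‖).congr_deriv ?_
    simp only [id]
    field_simp
  refine ⟨‖g 0‖ + C / a, fun t ht => ?_⟩
  have key : ‖Complex.exp (-l * t) * g t‖ ≤ ‖g 0‖ + C / a * Real.exp (a * t) := by
    refine image_norm_le_of_norm_deriv_right_le_deriv_boundary (a := 0) (b := t)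
      (f := fun t : ℝ => Complex.exp (-l * t) * g t)
      (f' := fun t : ℝ => Complex.exp (-l * t) * h t)
      (B := fun t => ‖g 0‖ + C / a * Real.exp (a * t))
      (B' := fun t => C * Real.exp (a * t))
      (fun s hs => ((hu s hs.1).mono Set.Icc_subset_Ici_self).continuousWithinAt)
      (fun s hs => (hu s hs.1).mono (Set.Ici_subset_Ici.2 hs.1)) ?_ hB ?_ ⟨ht, le_rfl⟩
    · simp only [Complex.ofReal_zero, mul_zero, Complex.exp_zero, one_mul, Real.exp_zero, mul_one]
      have : 0 ≤ C / a := by positivity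
      linarith
    · intro s hs
      rw [norm_mul, hnorm]
      calc Real.exp (-l.re * s) * ‖h s‖ ≤ Real.exp (-l.re * s) * (C * Real.exp (-δ * s)) := by
            gcongr; exact hh s hs.1
        _ = C * Real.exp (a * s) := by
            rw [mul_left_comm, ← Real.exp_add, ha]; ring_nf
  rw [norm_mul, hnorm] at key
  have h1 : 1 ≤ Real.exp (a * t) := Real.one_le_exp (by positivity)
  calc ‖g t‖ = Real.exp (l.re * t) * (Real.exp (-l.re * t) * ‖g t‖) := by
        rw [← mul_assoc, ← Real.exp_add]; simp
    _ ≤ Real.exp (l.re * t) * ((‖g 0‖ + C / a) * Real.exp (a * t)) := by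
        refine mul_le_mul_of_nonneg_left ?_ (Real.exp_pos _).le
        nlinarith [norm_nonneg (g 0)]
    _ = (‖g 0‖ + C / a) * Real.exp (-δ * t) := by
        rw [mul_left_comm, ← Real.exp_add, ha]; ring_nf

section Lyapunov

variable {p : ℕ}

/-- The pairing `vᵀ X w` of a real matrix with two complex vectors, as a real-linear map in `X`. -/
noncomputable def complexPairing (v w : Fin p → ℂ) : Matrix (Fin p) (Fin p) ℝ →ₗ[ℝ] ℂ where
  toFun X := v ⬝ᵥ (X.map (Complex.ofReal ·) *ᵥ w)
  map_add' X Y := by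
    rw [Matrix.map_add _ (by simp), add_mulVec, dotProduct_add]
  map_smul' r X := by
    have : (r • X).map (Complex.ofReal ·) = (r : ℂ) • X.map (Complex.ofReal ·) := by
      ext; simp
    rw [this, smul_mulVec, dotProduct_smul]
    simp

theorem complexPairing_apply (v w : Fin p → ℂ) (X : Matrix (Fin p) (Fin p) ℝ) :
    complexPairing v w X = v ⬝ᵥ (X.map (Complex.ofReal ·) *ᵥ w) := rfl

theorem complexPairing_mul (v w : Fin p → ℂ) (X K : Matrix (Fin p) (Fin p) ℝ) :
    complexPairing v w (X * K) =
      complexPairing v (toLin' (K.map (Complex.ofReal ·)) w) X := by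
  have : (X * K).map (Complex.ofReal ·) =
      X.map (Complex.ofReal ·) * K.map (Complex.ofReal ·) :=
    Matrix.map_mul (f := Complex.ofRealHom)
  simp [complexPairing_apply, this]

theorem complexPairing_transpose_mul (v w : Fin p → ℂ) (X K : Matrix (Fin p) (Fin p) ℝ) :
    complexPairing v w (Kᵀ * X) =
      complexPairing (toLin' (K.map (Complex.ofReal ·)) v) w X := by
  have : (Kᵀ * X).map (Complex.ofReal ·) =
      (K.map (Complex.ofReal ·))ᵀ * X.map (Complex.ofReal ·) :=
    Matrix.map_mul (f := Complex.ofRealHom)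
  rw [complexPairing_apply, this, ← mulVec_mulVec, dotProduct_mulVec, vecMul_transpose]
  rfl

variable {K : Matrix (Fin p) (Fin p) ℝ} {D : ℝ → Matrix (Fin p) (Fin p) ℝ}

theorem exists_norm_complexPairing_le_exp
    (hD : ∀ t : ℝ, 0 ≤ t → HasDerivWithinAt D (D t * K + Kᵀ * D t) (Set.Ici (0 : ℝ)) t)
    {μ ν : ℂ} {δ : ℝ} (hδ : (μ + ν).re < -δ) (i j : ℕ) (v w : Fin p → ℂ)
    (hv : ((toLin' (K.map (Complex.ofReal ·)) - μ • 1) ^ i) v = 0)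
    (hw : ((toLin' (K.map (Complex.ofReal ·)) - ν • 1) ^ j) w = 0) :
    ∃ C, ∀ t : ℝ, 0 ≤ t → ‖complexPairing v w (D t)‖ ≤ C * Real.exp (-δ * t) := by
  set f := toLin' (K.map (Complex.ofReal ·)) with hf
  induction i generalizing v w j with
  | zero =>
    have : v = 0 := by simpa using hv
    exact ⟨0, by simp [this, complexPairing_apply]⟩
  | succ i ihi =>
    induction j generalizing w with
    | zero =>
      have : w = 0 := by simpa using hw
      exact ⟨0, by simp [this, complexPairing_apply]⟩
    | succ j ihj =>
      obtain ⟨C₁, h₁⟩ := ihi (j + 1) ((f - μ • 1) v) w (by rwa [pow_succ] at hv) hw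
      obtain ⟨C₂, h₂⟩ := ihj ((f - ν • 1) w) (by rwa [pow_succ] at hw)
      refine exists_norm_le_exp_of_hasDerivWithinAt (l := μ + ν) (C := C₁ + C₂)
        (h := fun t => complexPairing ((f - μ • 1) v) w (D t) +
          complexPairing v ((f - ν • 1) w) (D t)) hδ (fun t ht => ?_) (fun t ht => ?_)
      · refine ((LinearMap.toContinuousLinearMap
          (complexPairing v w)).hasFDerivAt.comp_hasDerivWithinAt t (hD t ht)).congr_deriv ?_
        change complexPairing v w (D t * K + Kᵀ * D t) = _
        rw [map_add, complexPairing_mul, complexPairing_transpose_mul, ← hf]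
        simp only [complexPairing_apply, LinearMap.sub_apply, LinearMap.smul_apply,
          Module.End.one_apply, mulVec_sub, mulVec_smul, sub_dotProduct, dotProduct_sub,
          smul_dotProduct, dotProduct_smul, smul_eq_mul]
        ring
      · rw [add_mul]
        exact (norm_add_le _ _).trans (add_le_add (h₁ t ht) (h₂ t ht))

theorem tendsto_complexPairing_zero
    (hK : ∀ μ ∈ spectrum ℂ (K.map (Complex.ofReal ·)), μ.re < 0)
    (hD : ∀ t : ℝ, 0 ≤ t → HasDerivWithinAt D (D t * K + Kᵀ * D t) (Set.Ici (0 : ℝ)) t)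
    (v w : Fin p → ℂ) :
    Tendsto (fun t => complexPairing v w (D t)) atTop (nhds 0) := by
  set f : Module.End ℂ (Fin p → ℂ) := toLin' (K.map (Complex.ofReal ·)) with hf
  have hmem : ∀ (μ : ℂ) (v), v ∈ f.maxGenEigenspace μ → v = 0 ∨ μ.re < 0 := by
    intro μ v hv
    by_cases hμ : μ ∈ spectrum ℂ f
    · rw [hf, spectrum_toLin'] at hμ
      exact .inr (hK μ hμ)
    · left
      obtain ⟨k, hk⟩ := (f.mem_maxGenEigenspace μ v).1 hv
      have hu : IsUnit (f - μ • 1) := by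
        rw [spectrum.notMem_iff, Algebra.algebraMap_eq_smul_one] at hμ
        simpa using hμ.neg
      exact ((Module.End.isUnit_iff _).1 (hu.pow k)).1 (by simpa using hk)
  have htop := f.iSup_maxGenEigenspace_eq_top
  have hgen : ∀ μ ν : ℂ, ∀ v ∈ f.maxGenEigenspace μ, ∀ w ∈ f.maxGenEigenspace ν,
      Tendsto (fun t => complexPairing v w (D t)) atTop (nhds 0) := by
    intro μ ν v hv w hw
    rcases hmem μ v hv with rfl | hμ
    · simp [complexPairing_apply]
    rcases hmem ν w hw with rfl | hν
    · simp [complexPairing_apply]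
    obtain ⟨i, hi⟩ := (f.mem_maxGenEigenspace μ v).1 hv
    obtain ⟨j, hj⟩ := (f.mem_maxGenEigenspace ν w).1 hw
    have hδ : 0 < -(μ + ν).re / 2 := by rw [Complex.add_re]; linarith
    obtain ⟨C, hC⟩ := exists_norm_complexPairing_le_exp hD (δ := -(μ + ν).re / 2)
      (by linarith) i j v w hi hj
    refine squeeze_zero_norm' (eventually_atTop.2 ⟨0, hC⟩) ?_
    have : Tendsto (fun t : ℝ => Real.exp (-(-(μ + ν).re / 2) * t)) atTop (nhds 0) :=
      Real.tendsto_exp_atBot.comp (tendsto_id.const_mul_atTop_of_neg (by linarith))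
    simpa using this.const_mul C
  refine Submodule.iSup_induction _
    (motive := fun v => Tendsto (fun t => complexPairing v w (D t)) atTop (nhds 0))
    (htop ▸ Submodule.mem_top : v ∈ ⨆ μ, f.maxGenEigenspace μ)
    (fun μ v hv => ?_) (by simp [complexPairing_apply]) (fun v v' h h' => ?_)
  · refine Submodule.iSup_induction _
      (motive := fun w => Tendsto (fun t => complexPairing v w (D t)) atTop (nhds 0))
      (htop ▸ Submodule.mem_top : w ∈ ⨆ μ, f.maxGenEigenspace μ)
      (fun ν w hw => hgen μ ν v hv w hw) (by simp [complexPairing_apply]) (fun w w' h h' => ?_)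
    simpa [complexPairing_apply, mulVec_add, dotProduct_add] using h.add h'
  · simpa [complexPairing_apply, add_dotProduct] using h.add h'

/-- Solutions of the homogeneous Lyapunov equation of a stable matrix decay to zero. -/
theorem tendsto_zero_of_hasDerivWithinAt_lyapunov
    (hK : ∀ μ ∈ spectrum ℂ (K.map (Complex.ofReal ·)), μ.re < 0)
    (hD : ∀ t : ℝ, 0 ≤ t → HasDerivWithinAt D (D t * K + Kᵀ * D t) (Set.Ici (0 : ℝ)) t) :
    Tendsto D atTop (nhds 0) := by
  refine tendsto_pi_nhds.2 fun i => tendsto_pi_nhds.2 fun j => ?_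
  have h := tendsto_complexPairing_zero hK hD (Pi.single i 1) (Pi.single j 1)
  have hre := (Complex.continuous_re.tendsto 0).comp h
  simpa [Function.comp_def, complexPairing_apply] using hre

/-- The Lyapunov operator of a stable matrix is injective. -/
theorem eq_zero_of_mul_add_transpose_mul_eq_zero
    (hK : ∀ μ ∈ spectrum ℂ (K.map (Complex.ofReal ·)), μ.re < 0)
    {X : Matrix (Fin p) (Fin p) ℝ} (hX : X * K + Kᵀ * X = 0) : X = 0 := by
  refine tendsto_nhds_unique (tendsto_const_nhds (x := X) (f := atTop (α := ℝ)))
    (tendsto_zero_of_hasDerivWithinAt_lyapunov hK fun t _ => ?_)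
  rw [hX]
  exact hasDerivWithinAt_const _ _ _

end Lyapunov

/-- If every complex eigenvalue of `K` has strictly negative real part and
`S : [0,∞) → M_p(ℝ)` solves the linear matrix ODE `S'(t) = S(t)K + KᵀS(t) + M`, then there is
a unique `X₀` with `X₀K + KᵀX₀ + M = 0`, and `S(t) → X₀` as `t → ∞`. -/
theorem deterministic_wishart_mean_reversion
    (p : ℕ) (K M : Matrix (Fin p) (Fin p) ℝ)
    (hK : ∀ μ ∈ spectrum ℂ (K.map (Complex.ofReal ·)), μ.re < 0)
    (S : ℝ → Matrix (Fin p) (Fin p) ℝ)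
    (hS : ∀ t : ℝ, 0 ≤ t →
      HasDerivWithinAt S (S t * K + Kᵀ * S t + M) (Set.Ici (0:ℝ)) t) :
    (∃! X₀ : Matrix (Fin p) (Fin p) ℝ, X₀ * K + Kᵀ * X₀ + M = 0) ∧
    (∀ X₀ : Matrix (Fin p) (Fin p) ℝ, X₀ * K + Kᵀ * X₀ + M = 0 →
      Tendsto S atTop (nhds X₀)) := by
  constructor
  · let L : Matrix (Fin p) (Fin p) ℝ →ₗ[ℝ] Matrix (Fin p) (Fin p) ℝ :=
      LinearMap.mulRight ℝ K + LinearMap.mulLeft ℝ Kᵀ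
    have hL : ∀ X, L X = X * K + Kᵀ * X := fun X => rfl
    have hinj : Function.Injective L := (injective_iff_map_eq_zero L).2 fun X hX =>
      eq_zero_of_mul_add_transpose_mul_eq_zero hK hX
    obtain ⟨X₀, hX₀⟩ := LinearMap.injective_iff_surjective.1 hinj (-M)
    refine ⟨X₀, ?_, fun Y hY => hinj ?_⟩
    · simp [← hL, hX₀]
    · rw [hX₀, hL]
      exact eq_neg_of_add_eq_zero_left hY
  · intro X₀ hX₀
    have h := tendsto_zero_of_hasDerivWithinAt_lyapunov (D := fun t => S t - X₀) hK fun t ht => by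
      refine ((hS t ht).sub_const X₀).congr_deriv ?_
      rw [eq_neg_of_add_eq_zero_right hX₀, sub_mul, mul_sub]
      abel
    simpa using h.add_const X₀
end
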